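/- arXiv:2511.23012 — 7 statements merged into one kernel-verified Lean document; each statement's English description precedes it below -/
import Mathlib

section
/- Let G be a connected finite simple graph with diameter diam(G), and let S and T be two sets of vertices of G with |S| = |T| = k. Then T is reachable from S in at most k·diam(G) token-sliding steps. -/
/-- Two configurations (sets of tokens) are adjacent if one is obtained from the
other by sliding a single token along an edge. -/
def ConfigAdj {V : Type*} [DecidableEq V] (G : SimpleGraph V) (S S' : Finset V) : Prop :=
  ∃ x ∈ S, ∃ y ∉ S, G.Adj x y ∧ S' = insert y (S.erase x)

/-- `T` is reachable from `S` in at most `b` token-sliding steps. -/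
def ReachableIn {V : Type*} [DecidableEq V] (G : SimpleGraph V) (S T : Finset V) (b : ℕ) : Prop :=
  ∃ (ℓ : ℕ) (f : ℕ → Finset V), ℓ ≤ b ∧ f 0 = S ∧ f ℓ = T ∧
    ∀ i < ℓ, ConfigAdj G (f i) (f (i + 1))

theorem ReachableIn.refl {V : Type*} [DecidableEq V] (G : SimpleGraph V) (S : Finset V) (b : ℕ) :
    ReachableIn G S S b :=
  ⟨0, fun _ => S, Nat.zero_le _, rfl, rfl, fun _ hi => absurd hi (Nat.not_lt_zero _)⟩

theorem ReachableIn.mono {V : Type*} [DecidableEq V] {G : SimpleGraph V} {S T : Finset V}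
    {a b : ℕ} (h : ReachableIn G S T a) (hab : a ≤ b) : ReachableIn G S T b := by
  obtain ⟨ℓ, f, hℓ, hf⟩ := h
  exact ⟨ℓ, f, hℓ.trans hab, hf⟩

theorem ReachableIn.trans {V : Type*} [DecidableEq V] {G : SimpleGraph V} {S T U : Finset V}
    {a b : ℕ} (h₁ : ReachableIn G S T a) (h₂ : ReachableIn G T U b) :
    ReachableIn G S U (a + b) := by
  obtain ⟨m, f, hm, hf0, hfm, hf⟩ := h₁
  obtain ⟨n, g, hn, hg0, hgn, hg⟩ := h₂
  refine ⟨m + n, fun i => if i < m then f i else g (i - m), by omega, ?_, by simp [hgn], ?_⟩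
  · rcases Nat.eq_zero_or_pos m with rfl | hpos
    · simp [hg0, ← hfm, hf0]
    · simp [hpos, hf0]
  · intro i hi
    rcases lt_trichotomy (i + 1) m with h | h | h
    · simpa [h, show i < m by omega] using hf i (by omega)
    · have := hf i (by omega)
      rw [h, hfm, ← hg0] at this
      simpa [h, show i < m by omega] using this
    · have := hg (i - m) (by omega)
      rw [show i - m + 1 = i + 1 - m by omega] at this
      simpa [show ¬ i + 1 < m by omega, show ¬ i < m by omega] using this

theorem ConfigAdj.reachableIn {V : Type*} [DecidableEq V] {G : SimpleGraph V} {S T : Finset V}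
    (h : ConfigAdj G S T) : ReachableIn G S T 1 := by
  refine ⟨1, fun i => if i = 0 then S else T, le_rfl, by simp, by simp, fun i hi => ?_⟩
  obtain rfl : i = 0 := by omega
  simpa using h

/-- A walk from an occupied vertex to an empty one lets its token be transferred
in at most as many slides as the walk has edges, even past other tokens. -/
theorem SimpleGraph.Walk.reachableIn_insert_erase {V : Type*} [DecidableEq V] {G : SimpleGraph V}
    {s t : V} (p : G.Walk s t) {S : Finset V} (hs : s ∈ S) (ht : t ∉ S) :
    ReachableIn G S (insert t (S.erase s)) p.length := by
  induction p generalizing S with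
  | nil => exact absurd hs ht
  | @cons s u t hsu p ih =>
    rw [SimpleGraph.Walk.length_cons]
    have hne : s ≠ u := hsu.ne
    have hst : s ≠ t := fun h => ht (h ▸ hs)
    by_cases hu : u ∈ S
    · have hut : u ≠ t := fun h => ht (h ▸ hu)
      refine (ih hu ht).trans (ConfigAdj.reachableIn ⟨s, ?_, u, ?_, hsu, ?_⟩)
      · simp [hs, hne]
      · simp [hut]
      · ext x
        simp only [Finset.mem_insert, Finset.mem_erase]
        grind
    · have hslide : ReachableIn G S (insert u (S.erase s)) 1 :=
        ConfigAdj.reachableIn ⟨s, hs, u, hu, hsu, rfl⟩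
      by_cases hut : u = t
      · subst hut
        exact hslide.mono (by omega)
      · have h := hslide.trans (ih (S := insert u (S.erase s)) (by simp)
          (by simp [ht, Ne.symm hut]))
        rw [Finset.erase_insert (by simp [hu])] at h
        exact h.mono (by omega)

theorem reachableIn_card_sdiff_mul {V : Type*} [DecidableEq V] {G : SimpleGraph V} {d : ℕ}
    (hd : ∀ u v : V, ∃ p : G.Walk u v, p.length ≤ d) {S T : Finset V} (h : S.card = T.card) :
    ReachableIn G S T ((S \ T).card * d) := by
  induction hn : (S \ T).card generalizing S with
  | zero =>
    have hST : S ⊆ T := Finset.sdiff_eq_empty_iff_subset.1 (Finset.card_eq_zero.1 hn)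
    rw [Finset.eq_of_subset_of_card_le hST h.ge]
    exact ReachableIn.refl G T _
  | succ n ih =>
    have hTS : (T \ S).card = n + 1 := by rw [← Finset.card_sdiff_comm h, hn]
    obtain ⟨s, hs⟩ := Finset.card_pos.1 (by omega : 0 < (S \ T).card)
    obtain ⟨t, ht⟩ := Finset.card_pos.1 (by omega : 0 < (T \ S).card)
    have hs' := Finset.mem_sdiff.1 hs
    have ht' := Finset.mem_sdiff.1 ht
    obtain ⟨p, hp⟩ := hd s t
    have hmove := (p.reachableIn_insert_erase hs'.1 ht'.2).mono hp
    have hcard : (insert t (S.erase s)).card = T.card := by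
      rw [Finset.card_insert_of_notMem (by simp [ht'.2]), Finset.card_erase_add_one hs'.1, h]
    have hsdiff : (insert t (S.erase s) \ T).card = n := by
      rw [Finset.insert_sdiff_of_mem _ ht'.1, Finset.erase_sdiff_comm,
        Finset.card_erase_of_mem hs, hn, Nat.add_sub_cancel]
    exact (hmove.trans (ih hcard hsdiff)).mono (by rw [Nat.succ_mul, Nat.add_comm])

theorem stmt_0 {V : Type*} [Fintype V] [DecidableEq V] (G : SimpleGraph V)
    (hG : G.Connected) (k : ℕ) (S T : Finset V)
    (hS : S.card = k) (hT : T.card = k) :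
    ReachableIn G S T (k * G.diam) := by
  have := hG.nonempty
  refine (reachableIn_card_sdiff_mul (fun u v => ?_) (hS.trans hT.symm)).mono
    (Nat.mul_le_mul_right _ (hS ▸ Finset.card_le_card Finset.sdiff_subset))
  obtain ⟨p, hp⟩ := hG.exists_walk_length_eq_dist u v
  exact ⟨p, hp.le.trans (SimpleGraph.dist_le_diam
    (SimpleGraph.connected_iff_ediam_ne_top.1 hG))⟩
end

section
/- Let G be a finite simple graph and k a natural number. Let G' be the graph with V(G') = V(G) ∪ {s} ∪ {v_i^1, v_i^2 : i ∈ [k+2]} (all new vertices distinct from V(G)) and E(G') = E(G) ∪ {sv : v ∈ V(G)} ∪ {s v_i^1, s v_i^2, v_i^1 v_i^2 : i ∈ [k+2]}. Then G has a feedback vertex set of size at most k if and only if G' has a feedback vertex set of size at most k + 1. -/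
/-- `F` is a feedback vertex set of `G`: the subgraph induced on the complement
of `F` is acyclic. -/
def IsFVS {V : Type*} (G : SimpleGraph V) (F : Finset V) : Prop :=
  (G.induce ((↑F : Set V)ᶜ)).IsAcyclic

/-- The graph `G'` obtained from `G` by adding a universal vertex `s` (the vertex
`Sum.inr (Sum.inl ())`) together with `k + 2` triangles `s, vᵢ¹, vᵢ²` (the vertices
`Sum.inr (Sum.inr (i, j))`): `s` is adjacent to every other vertex, and
`vᵢ¹ vᵢ²` is an edge for each `i ∈ [k+2]`. -/
def fvsGadget {V : Type*} (G : SimpleGraph V) (k : ℕ) :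
    SimpleGraph (V ⊕ (Unit ⊕ (Fin (k + 2) × Fin 2))) :=
  SimpleGraph.fromRel (fun x y =>
    (∃ a b, x = Sum.inl a ∧ y = Sum.inl b ∧ G.Adj a b) ∨
    (x = Sum.inr (Sum.inl ()) ∧ y ≠ Sum.inr (Sum.inl ())) ∨
    (∃ (i : Fin (k + 2)) (j j' : Fin 2), j ≠ j' ∧
      x = Sum.inr (Sum.inr (i, j)) ∧ y = Sum.inr (Sum.inr (i, j'))))

namespace SimpleGraph

theorem Walk.apply_eq_of_mem_support {V ι : Type*} {H : SimpleGraph V} {f : V → ι}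
    (hf : ∀ u v, H.Adj u v → f u = f v) {u v : V} (w : H.Walk u v) :
    ∀ x ∈ w.support, f x = f u := by
  induction w with
  | nil => simp
  | cons h p ih =>
    intro x hx
    rw [Walk.support_cons, List.mem_cons] at hx
    rcases hx with rfl | hx
    · rfl
    · rw [ih x hx, hf _ _ h]

/-- A graph is acyclic if it is acyclic on each fiber of a function that is constant along edges. -/
theorem IsAcyclic.of_induce_fibers {V ι : Type*} {H : SimpleGraph V} (f : V → ι)
    (hf : ∀ u v, H.Adj u v → f u = f v)
    (h : ∀ i, (H.induce {v | f v = i}).IsAcyclic) : H.IsAcyclic := by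
  intro u w hw
  have hs : ∀ x ∈ w.support, x ∈ {v | f v = f u} := w.apply_eq_of_mem_support hf
  refine h (f u) (w.induce _ hs) ?_
  rw [← Walk.isCycle_map_iff_of_injective (f := (Embedding.induce (G := H) {v | f v = f u}).toHom)
    (Embedding.induce (G := H) {v | f v = f u}).injective, Walk.map_induce]
  exact hw

end SimpleGraph

section fvsGadget

variable {V : Type*} (G : SimpleGraph V) (k : ℕ)

@[simp] theorem fvsGadget_adj_inl_inl (a b : V) :
    (fvsGadget G k).Adj (Sum.inl a) (Sum.inl b) ↔ G.Adj a b := by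
  simp only [fvsGadget, SimpleGraph.fromRel_adj]
  have := G.ne_of_adj (a := a) (b := b)
  simp [G.adj_comm b a]
  exact this

@[simp] theorem fvsGadget_adj_inl_inr_inr (a : V) (x : Fin (k + 2) × Fin 2) :
    ¬ (fvsGadget G k).Adj (Sum.inl a) (Sum.inr (Sum.inr x)) := by
  simp [fvsGadget]

@[simp] theorem fvsGadget_adj_inr_inr (x y : Fin (k + 2) × Fin 2) :
    (fvsGadget G k).Adj (Sum.inr (Sum.inr x)) (Sum.inr (Sum.inr y)) ↔
      x.1 = y.1 ∧ x.2 ≠ y.2 := by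
  obtain ⟨i, j⟩ := x
  obtain ⟨i', j'⟩ := y
  simp [fvsGadget]
  grind

@[simp] theorem fvsGadget_adj_center_inr (x : Fin (k + 2) × Fin 2) :
    (fvsGadget G k).Adj (Sum.inr (Sum.inl ())) (Sum.inr (Sum.inr x)) := by
  simp [fvsGadget]

variable {G k}

theorem IsFVS.preimage_inl {F' : Finset (V ⊕ (Unit ⊕ (Fin (k + 2) × Fin 2)))}
    (h : IsFVS (fvsGadget G k) F') :
    IsFVS G (F'.preimage Sum.inl Sum.inl_injective.injOn) := by
  let φ : G.induce ((↑(F'.preimage Sum.inl Sum.inl_injective.injOn) : Set V)ᶜ) →g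
      (fvsGadget G k).induce ((↑F' : Set _)ᶜ) :=
    { toFun := fun v => ⟨Sum.inl v.1, by simpa using v.2⟩
      map_rel' := by
        intro a b hab
        simpa using hab }
  refine SimpleGraph.IsAcyclic.comap φ ?_ h
  intro a b hab
  exact Subtype.ext (Sum.inl_injective (congrArg Subtype.val hab))

theorem IsFVS.exists_mem_of_center_notMem {F' : Finset (V ⊕ (Unit ⊕ (Fin (k + 2) × Fin 2)))}
    (h : IsFVS (fvsGadget G k) F') (hs : Sum.inr (Sum.inl ()) ∉ F') (i : Fin (k + 2)) :
    ∃ j, Sum.inr (Sum.inr (i, j)) ∈ F' := by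
  classical
  by_contra! hi
  have hc := SimpleGraph.IsAcyclic.cliqueFree h (le_refl 3)
  refine hc {⟨Sum.inr (Sum.inl ()), by simpa using hs⟩,
    ⟨Sum.inr (Sum.inr (i, 0)), by simpa using hi 0⟩,
    ⟨Sum.inr (Sum.inr (i, 1)), by simpa using hi 1⟩} ?_
  rw [SimpleGraph.is3Clique_triple_iff]
  simp

theorem IsFVS.center_mem {F' : Finset (V ⊕ (Unit ⊕ (Fin (k + 2) × Fin 2)))}
    (h : IsFVS (fvsGadget G k) F') (hcard : F'.card ≤ k + 1) :
    Sum.inr (Sum.inl ()) ∈ F' := by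
  by_contra hs
  choose j hj using h.exists_mem_of_center_notMem hs
  have := Finset.card_le_card_of_injOn (s := Finset.univ)
    (fun i => (Sum.inr (Sum.inr (i, j i)) : V ⊕ (Unit ⊕ (Fin (k + 2) × Fin 2))))
    (fun i _ => hj i) (by intro a _ b _ hab; simp at hab; exact hab.1)
  simp at this
  omega

theorem IsFVS.insert_center [DecidableEq V] {F : Finset V} (h : IsFVS G F) :
    IsFVS (fvsGadget G k)
      (insert (Sum.inr (Sum.inl ())) (F.map Function.Embedding.inl)) := by
  let f : V ⊕ (Unit ⊕ (Fin (k + 2) × Fin 2)) → Option (Fin (k + 2)) :=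
    Sum.elim (fun _ => none) (Sum.elim (fun _ => none) (fun x => some x.1))
  refine SimpleGraph.IsAcyclic.of_induce_fibers (fun v => f v.1) ?_ ?_
  · rintro ⟨u | ⟨⟩ | x, hu⟩ ⟨v | ⟨⟩ | y, hv⟩ huv
    all_goals simp [f] at hu hv huv ⊢
    · simp [SimpleGraph.adj_comm] at huv
    · exact huv.1
  · rintro (_ | i)
    · have key : ∀ x : {v : ((↑(insert (Sum.inr (Sum.inl ())) (F.map Function.Embedding.inl) :
          Finset (V ⊕ (Unit ⊕ (Fin (k + 2) × Fin 2)))) : Set _)ᶜ : Set _) | f v.1 = none},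
          ∃ a : ((↑F : Set V)ᶜ : Set V), x.1.1 = Sum.inl a.1 := by
        rintro ⟨⟨u | ⟨⟩ | x, hu⟩, hx⟩
        · exact ⟨⟨u, by simpa using hu⟩, rfl⟩
        · simp at hu
        · simp [f] at hx
      choose g hg using key
      refine SimpleGraph.IsAcyclic.comap (G' := G.induce ((↑F : Set V)ᶜ)) ⟨g, ?_⟩ ?_ h
      · intro a b hab
        simpa [hg] using hab
      · intro a b hab
        apply Subtype.ext
        apply Subtype.ext
        rw [hg, hg]
        exact congrArg (fun z => Sum.inl z.1) hab
    · apply SimpleGraph.IsAcyclic.of_card_le_two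
      have key : ∀ x : {v : ((↑(insert (Sum.inr (Sum.inl ())) (F.map Function.Embedding.inl) :
          Finset (V ⊕ (Unit ⊕ (Fin (k + 2) × Fin 2)))) : Set _)ᶜ : Set _) | f v.1 = some i},
          ∃ j : Fin 2, x.1.1 = Sum.inr (Sum.inr (i, j)) := by
        rintro ⟨⟨u | ⟨⟩ | x, hu⟩, hx⟩
        · simp [f] at hx
        · simp [f] at hx
        · simp [f] at hx
          exact ⟨x.2, by simp [← hx]⟩
      choose g hg using key
      have hinj : Function.Injective g := by
        intro a b hab
        apply Subtype.ext
        apply Subtype.ext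
        rw [hg, hg, hab]
      simpa using ENat.card_le_card_of_injective hinj

end fvsGadget

theorem stmt_4 {V : Type*} [Fintype V] [DecidableEq V] (G : SimpleGraph V) (k : ℕ) :
    (∃ F : Finset V, IsFVS G F ∧ F.card ≤ k) ↔
    (∃ F' : Finset (V ⊕ (Unit ⊕ (Fin (k + 2) × Fin 2))),
      IsFVS (fvsGadget G k) F' ∧ F'.card ≤ k + 1) := by
  constructor
  · rintro ⟨F, hF, hk⟩
    refine ⟨_, hF.insert_center, (Finset.card_insert_le _ _).trans ?_⟩
    simpa using hk
  · rintro ⟨F', hF', hk⟩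
    refine ⟨_, hF'.preimage_inl, ?_⟩
    have hs := hF'.center_mem hk
    have hsub : (F'.preimage Sum.inl Sum.inl_injective.injOn).map Function.Embedding.inl ⊆
        F'.erase (Sum.inr (Sum.inl ())) := by
      intro x hx
      simp only [Finset.mem_map, Finset.mem_preimage] at hx
      obtain ⟨a, ha, rfl⟩ := hx
      simpa using ha
    have hle := Finset.card_le_card hsub
    rw [Finset.card_map, Finset.card_erase_of_mem hs] at hle
    omega
end

section
/- Let G be a finite simple graph and k a natural number. Let G' be the graph with V(G') = V(G) ∪ {s} ∪ {v_i^1, v_i^2 : i ∈ [k+2]} (all new vertices distinct from V(G)) and E(G') = E(G) ∪ {sv : v ∈ V(G)} ∪ {s v_i^1, s v_i^2, v_i^1 v_i^2 : i ∈ [k+2]}. Then every feedback vertex set F of G' with |F| ≤ k + 1 contains s, and F ∩ V(G) is a feedback vertex set of G of size at most k. -/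
/-- An acyclic graph contains no triangle. -/
theorem SimpleGraph.IsAcyclic.not_triangle {V : Type*} {G : SimpleGraph V} (h : G.IsAcyclic)
    {a b c : V} (hab : G.Adj a b) (hbc : G.Adj b c) (hca : G.Adj c a) : False := by
  refine h (.cons hab (.cons hbc (.cons hca .nil))) ?_
  have h1 := hab.ne
  have h2 := hbc.ne
  have h3 := hca.ne
  simp [SimpleGraph.Walk.isCycle_def, SimpleGraph.Walk.isTrail_def, h1, h2, h3, h1.symm, h3.symm]

/-- A feedback vertex set of the gadget graph of size at most `k + 1` contains the
universal vertex. -/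
theorem universal_mem_of_isFVS_fvsGadget {V : Type*} {G : SimpleGraph V} {k : ℕ}
    {F : Finset (V ⊕ (Unit ⊕ (Fin (k + 2) × Fin 2)))}
    (hF : IsFVS (fvsGadget G k) F) (hFcard : F.card ≤ k + 1) :
    Sum.inr (Sum.inl ()) ∈ F := by
  by_contra hs
  have hhit : ∀ i : Fin (k + 2), ∃ j : Fin 2, Sum.inr (Sum.inr (i, j)) ∈ F := by
    intro i
    by_contra! h
    refine SimpleGraph.IsAcyclic.not_triangle hF
      (a := ⟨Sum.inr (Sum.inl ()), by simpa using hs⟩)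
      (b := ⟨Sum.inr (Sum.inr (i, 0)), by simpa using h 0⟩)
      (c := ⟨Sum.inr (Sum.inr (i, 1)), by simpa using h 1⟩) ?_ ?_ ?_ <;>
    simp [fvsGadget]
  choose f hf using hhit
  have hcard := Finset.card_le_card_of_injOn (s := Finset.univ) (t := F)
    (fun i => Sum.inr (Sum.inr (i, f i))) (fun i _ => hf i) (fun i _ j _ hij => by simp_all)
  simp at hcard
  omega

/-- A feedback vertex set of the gadget graph restricts to one of the base graph. -/
theorem IsFVS.filter_inl {V : Type*} [Fintype V] [DecidableEq V] {G : SimpleGraph V} {k : ℕ}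
    {F : Finset (V ⊕ (Unit ⊕ (Fin (k + 2) × Fin 2)))} (hF : IsFVS (fvsGadget G k) F) :
    IsFVS G (Finset.univ.filter fun a : V => Sum.inl a ∈ F) := by
  refine SimpleGraph.IsAcyclic.comap
    ⟨fun a => ⟨Sum.inl a.1, by simpa using a.2⟩, ?_⟩ ?_ hF
  · intro a b hab
    have hadj : G.Adj a.1 b.1 := hab
    simp [fvsGadget, hadj, hadj.ne]
  · intro a b hab
    simpa [Subtype.ext_iff] using hab

theorem stmt_5 {V : Type*} [Fintype V] [DecidableEq V] (G : SimpleGraph V) (k : ℕ)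
    (F : Finset (V ⊕ (Unit ⊕ (Fin (k + 2) × Fin 2))))
    (hF : IsFVS (fvsGadget G k) F) (hFcard : F.card ≤ k + 1) :
    Sum.inr (Sum.inl ()) ∈ F ∧
      IsFVS G (Finset.univ.filter fun a : V => Sum.inl a ∈ F) ∧
      (Finset.univ.filter fun a : V => Sum.inl a ∈ F).card ≤ k := by
  have hs := universal_mem_of_isFVS_fvsGadget hF hFcard
  refine ⟨hs, hF.filter_inl, ?_⟩
  have hcard := Finset.card_le_card_of_injOn
    (s := Finset.univ.filter fun a : V => Sum.inl a ∈ F) (t := F.erase (Sum.inr (Sum.inl ())))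
    Sum.inl (fun a ha => by simpa using ha) Sum.inl_injective.injOn
  rw [Finset.card_erase_of_mem hs] at hcard
  omega
end

section
/- Let G be a finite simple graph and let G' be obtained from G by adding, for each edge uv of G, a new vertex e_uv adjacent exactly to u and v (so u, v, e_uv form a triangle in G'). Then (i) a set S ⊆ V(G) is a vertex cover of G if and only if S is a feedback vertex set of G', and (ii) for every natural number k, G has a vertex cover of size at most k if and only if G' has a feedback vertex set of size at most k. -/
/-- `C` is a vertex cover of `G`: every edge has an endpoint in `C`. -/
def IsVertexCover {V : Type*} (G : SimpleGraph V) (C : Finset V) : Prop :=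
  ∀ ⦃u v : V⦄, G.Adj u v → u ∈ C ∨ v ∈ C

/-- The graph obtained from `G` by adding, for each edge `uv` of `G`, a new
vertex `e_uv` adjacent exactly to `u` and `v`. -/
def triangulate {V : Type*} (G : SimpleGraph V) : SimpleGraph (V ⊕ G.edgeSet) :=
  SimpleGraph.fromRel (fun x y =>
    (∃ a b, x = Sum.inl a ∧ y = Sum.inl b ∧ G.Adj a b) ∨
    (∃ (a : V) (e : G.edgeSet), x = Sum.inl a ∧ y = Sum.inr e ∧ a ∈ (e : Sym2 V)))

/-- A graph is acyclic if every edge has an endpoint in a set of vertices each of which has at most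
one neighbour. -/
theorem SimpleGraph.isAcyclic_of_subsingleton_neighborSet {V : Type*} {G : SimpleGraph V}
    (L : Set V) (hL : ∀ v ∈ L, (G.neighborSet v).Subsingleton)
    (hG : ∀ ⦃v w⦄, G.Adj v w → v ∈ L ∨ w ∈ L) : G.IsAcyclic := by
  classical
  intro v c hc
  have not_mem : ∀ w ∈ c.support, w ∉ L := fun w hw hwL ↦ by
    have hr := hc.rotate hw
    exact hr.snd_ne_penultimate <| hL w hwL (SimpleGraph.Walk.adj_snd hr.not_nil)
      (SimpleGraph.Walk.adj_penultimate hr.not_nil).symm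
  rcases hG (SimpleGraph.Walk.adj_snd hc.not_nil) with h | h
  · exact not_mem _ c.start_mem_support h
  · exact not_mem _ (c.getVert_mem_support 1) h

theorem SimpleGraph.IsAcyclic.not_adj_of_adj_of_adj {V : Type*} {G : SimpleGraph V}
    (hG : G.IsAcyclic) {u v w : V} (huv : G.Adj u v) (hvw : G.Adj v w) : ¬ G.Adj u w := by
  intro huw
  have hpath : (SimpleGraph.Walk.cons huv (.cons hvw .nil)).IsPath := by
    simp [SimpleGraph.Walk.isPath_def, huv.ne, hvw.ne, huw.ne]
  exact hvw.ne (hG.eq_snd_of_adj_start (w := w) hpath huw (by simp)).symm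

@[simp]
theorem triangulate_adj_inl_inl {V : Type*} {G : SimpleGraph V} {a b : V} :
    (triangulate G).Adj (.inl a) (.inl b) ↔ G.Adj a b := by
  simp only [triangulate, SimpleGraph.fromRel_adj]
  constructor
  · rintro ⟨-, h⟩
    simpa [G.adj_comm b a] using h
  · intro h
    simpa [G.adj_comm b a, h] using h.ne

@[simp]
theorem triangulate_adj_inl_inr {V : Type*} {G : SimpleGraph V} {a : V} {e : G.edgeSet} :
    (triangulate G).Adj (.inl a) (.inr e) ↔ a ∈ (e : Sym2 V) := by
  simp [triangulate]

@[simp]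
theorem triangulate_adj_inr_inl {V : Type*} {G : SimpleGraph V} {a : V} {e : G.edgeSet} :
    (triangulate G).Adj (.inr e) (.inl a) ↔ a ∈ (e : Sym2 V) := by
  rw [SimpleGraph.adj_comm, triangulate_adj_inl_inr]

@[simp]
theorem not_triangulate_adj_inr_inr {V : Type*} {G : SimpleGraph V} {e f : G.edgeSet} :
    ¬ (triangulate G).Adj (.inr e) (.inr f) := by
  simp [triangulate]

theorem IsVertexCover.isFVS_triangulate {V : Type*} {G : SimpleGraph V} {S : Finset V}
    (hS : IsVertexCover G S) :
    IsFVS (triangulate G) (S.map ⟨Sum.inl, Sum.inl_injective⟩) := by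
  refine SimpleGraph.isAcyclic_of_subsingleton_neighborSet {x | x.1.isRight} ?_ ?_
  · rintro ⟨a | e, he⟩ hx
    · simp at hx
    · rintro ⟨a | f, ha⟩ hadj ⟨b | g, hb⟩ hadj'
      · simp only [SimpleGraph.mem_neighborSet, SimpleGraph.induce_adj,
          triangulate_adj_inr_inl] at hadj hadj'
        have haS : a ∉ S := by simpa using ha
        have hbS : b ∉ S := by simpa using hb
        by_contra hne
        have hab : a ≠ b := fun h ↦ hne (by simp [h])
        have hG : G.Adj a b := by
          rw [← SimpleGraph.mem_edgeSet, ← (Sym2.mem_and_mem_iff hab).1 ⟨hadj, hadj'⟩]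
          exact e.2
        exact (hS hG).elim haS hbS
      all_goals simp at hadj hadj'
  · rintro ⟨a | e, ha⟩ ⟨b | f, hb⟩ hadj
    · have haS : a ∉ S := by simpa using ha
      have hbS : b ∉ S := by simpa using hb
      exact ((hS (by simpa using hadj)).elim haS hbS).elim
    all_goals simp

/-- A feedback vertex set of `triangulate G` meets the triangle on every edge of `G`. -/
theorem IsFVS.mem_of_adj {V : Type*} {G : SimpleGraph V} {F : Finset (V ⊕ G.edgeSet)}
    (hF : IsFVS (triangulate G) F) {u v : V} (h : G.Adj u v) :
    .inl u ∈ F ∨ .inl v ∈ F ∨ .inr ⟨s(u, v), h⟩ ∈ F := by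
  by_contra! hn
  obtain ⟨hu, hv, he⟩ := hn
  refine SimpleGraph.IsAcyclic.not_adj_of_adj_of_adj (u := ⟨.inl u, by simpa using hu⟩)
    (v := ⟨.inl v, by simpa using hv⟩) (w := ⟨.inr ⟨s(u, v), h⟩, by simpa using he⟩) hF ?_ ?_ ?_
  all_goals simp [h]

theorem stmt_6 {V : Type*} [Fintype V] [DecidableEq V] (G : SimpleGraph V)
    [DecidableRel G.Adj] :
    (∀ S : Finset V, IsVertexCover G S ↔
      IsFVS (triangulate G) (S.map ⟨Sum.inl, Sum.inl_injective⟩)) ∧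
    (∀ k : ℕ, (∃ C : Finset V, IsVertexCover G C ∧ C.card ≤ k) ↔
      (∃ F : Finset (V ⊕ G.edgeSet), IsFVS (triangulate G) F ∧ F.card ≤ k)) := by
  have of_isFVS (S : Finset V)
      (hS : IsFVS (triangulate G) (S.map ⟨Sum.inl, Sum.inl_injective⟩)) : IsVertexCover G S := by
    intro u v h
    simpa using hS.mem_of_adj h
  refine ⟨fun S ↦ ⟨IsVertexCover.isFVS_triangulate, of_isFVS S⟩, fun k ↦ ⟨?_, ?_⟩⟩
  · rintro ⟨C, hC, hk⟩
    exact ⟨_, hC.isFVS_triangulate, by simpa using hk⟩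
  · rintro ⟨F, hF, hk⟩
    let f : V ⊕ G.edgeSet → V := Sum.elim id fun e ↦ (e : Sym2 V).out.1
    refine ⟨F.image f, fun u v h ↦ ?_, Finset.card_image_le.trans hk⟩
    rcases hF.mem_of_adj h with hu | hv | he
    · exact .inl (Finset.mem_image_of_mem f hu)
    · exact .inr (Finset.mem_image_of_mem f hv)
    · have hmem : s(u, v).out.1 ∈ F.image f := Finset.mem_image_of_mem f he
      rcases Sym2.mem_iff.1 s(u, v).out_fst_mem with h' | h'
      · exact .inl (h' ▸ hmem)
      · exact .inr (h' ▸ hmem)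
end

section
/- Let G be a finite simple graph whose vertex set is partitioned into a clique Q and an independent set I, and suppose every vertex of Q has at least one neighbor in I. Then a set C ⊆ V(G) is a minimal vertex cover of G if and only if C = Q or C = (Q \ {v}) ∪ N(v) for some v ∈ Q, where N(v) is the open neighborhood of v. Moreover, these sets are pairwise distinct, so G has exactly |Q| + 1 minimal vertex covers. -/
/-- `C` is a minimal vertex cover of `G`: it is a vertex cover and no proper
subset of it is a vertex cover. -/
def MinimalVertexCover {V : Type*} (G : SimpleGraph V) (C : Finset V) : Prop :=
  IsVertexCover G C ∧ ∀ C' ⊂ C, ¬ IsVertexCover G C'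

theorem IsVertexCover.neighborFinset_subset {V : Type*} {G : SimpleGraph V} {C : Finset V}
    (hC : IsVertexCover G C) {v : V} [Fintype (G.neighborSet v)] (hv : v ∉ C) :
    G.neighborFinset v ⊆ C := fun u hu =>
  (hC ((G.mem_neighborFinset v u).1 hu)).resolve_left hv

theorem IsVertexCover.minimalVertexCover {V : Type*} {G : SimpleGraph V} {C : Finset V}
    (hC : IsVertexCover G C) (h : ∀ v ∈ C, ∃ u ∉ C, G.Adj v u) : MinimalVertexCover G C := by
  refine ⟨hC, fun C' hss hC' => ?_⟩
  obtain ⟨v, hv, hv'⟩ := Finset.exists_of_ssubset hss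
  obtain ⟨u, hu, huv⟩ := h v hv
  exact (hC' huv).elim hv' fun hu' => hu (hss.1 hu')

theorem MinimalVertexCover.eq_of_subset {V : Type*} {G : SimpleGraph V} {C D : Finset V}
    (hC : MinimalVertexCover G C) (hD : IsVertexCover G D) (h : D ⊆ C) : C = D := by
  by_contra hne
  exact hC.2 D (h.ssubset_of_ne (Ne.symm hne)) hD

theorem notMem_erase_union_neighborFinset {V : Type*} [DecidableEq V] (G : SimpleGraph V)
    (Q : Finset V) (v : V) [Fintype (G.neighborSet v)] :
    v ∉ Q.erase v ∪ G.neighborFinset v := by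
  simp

theorem stmt_8 {V : Type*} [Fintype V] [DecidableEq V] (G : SimpleGraph V)
    [DecidableRel G.Adj] (Q I : Finset V)
    (hpart : Q ∪ I = Finset.univ) (hdisj : Disjoint Q I)
    (hclique : G.IsClique (↑Q : Set V))
    (hindep : ∀ a ∈ I, ∀ b ∈ I, ¬ G.Adj a b)
    (hnbr : ∀ v ∈ Q, ∃ u ∈ I, G.Adj v u) :
    (∀ C : Finset V, MinimalVertexCover G C ↔
      (C = Q ∨ ∃ v ∈ Q, C = Q.erase v ∪ G.neighborFinset v)) ∧
    (∀ v ∈ Q, Q ≠ Q.erase v ∪ G.neighborFinset v) ∧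
    (∀ v ∈ Q, ∀ w ∈ Q,
      Q.erase v ∪ G.neighborFinset v = Q.erase w ∪ G.neighborFinset w → v = w) ∧
    {C : Finset V | MinimalVertexCover G C}.ncard = Q.card + 1 := by
  have hcompl : ∀ v, v ∉ Q → v ∈ I := fun v hv =>
    (Finset.mem_union.1 (hpart ▸ Finset.mem_univ v)).resolve_left hv
  have hQ : IsVertexCover G Q := fun u v huv => by
    by_contra! h
    exact hindep u (hcompl u h.1) v (hcompl v h.2) huv
  have hQmin : MinimalVertexCover G Q := hQ.minimalVertexCover fun v hv => by
    obtain ⟨u, hu, huv⟩ := hnbr v hv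
    exact ⟨u, Finset.disjoint_right.1 hdisj hu, huv⟩
  have hcover : ∀ v, IsVertexCover G (Q.erase v ∪ G.neighborFinset v) := fun v x y hxy => by
    simp only [Finset.mem_union, Finset.mem_erase, SimpleGraph.mem_neighborFinset]
    by_cases hx : x = v
    · exact .inr (.inr (hx ▸ hxy))
    by_cases hy : y = v
    · exact .inl (.inr (hy ▸ hxy.symm))
    exact (hQ hxy).imp (fun h => .inl ⟨hx, h⟩) fun h => .inl ⟨hy, h⟩
  have hmin : ∀ v ∈ Q, MinimalVertexCover G (Q.erase v ∪ G.neighborFinset v) := fun v hv =>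
    (hcover v).minimalVertexCover fun w hw => by
      refine ⟨v, notMem_erase_union_neighborFinset G Q v, ?_⟩
      rcases Finset.mem_union.1 hw with hw | hw
      · exact hclique (Finset.mem_of_mem_erase hw) hv (Finset.ne_of_mem_erase hw)
      · exact ((G.mem_neighborFinset v w).1 hw).symm
  have hiff : ∀ C : Finset V, MinimalVertexCover G C ↔
      (C = Q ∨ ∃ v ∈ Q, C = Q.erase v ∪ G.neighborFinset v) := fun C => by
    constructor
    · intro hC
      by_cases hQC : Q ⊆ C
      · exact .inl (hC.eq_of_subset hQ hQC)
      obtain ⟨v, hv, hvC⟩ := Finset.not_subset.1 hQC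
      refine .inr ⟨v, hv, hC.eq_of_subset (hcover v) (Finset.union_subset (fun w hw => ?_)
        (hC.1.neighborFinset_subset hvC))⟩
      exact (hC.1 (hclique (Finset.mem_of_mem_erase hw) hv
        (Finset.ne_of_mem_erase hw))).resolve_right hvC
    · rintro (rfl | ⟨v, hv, rfl⟩)
      exacts [hQmin, hmin v hv]
  have hne : ∀ v ∈ Q, Q ≠ Q.erase v ∪ G.neighborFinset v := fun v hv h =>
    notMem_erase_union_neighborFinset G Q v (h ▸ hv)
  have hinj : ∀ v ∈ Q, ∀ w ∈ Q,
      Q.erase v ∪ G.neighborFinset v = Q.erase w ∪ G.neighborFinset w → v = w := by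
    intro v hv w _ h
    by_contra hvw
    exact notMem_erase_union_neighborFinset G Q v
      (h ▸ Finset.mem_union_left _ (Finset.mem_erase.2 ⟨hvw, hv⟩))
  refine ⟨hiff, hne, hinj, ?_⟩
  have hset : {C : Finset V | MinimalVertexCover G C} =
      ↑(insert Q (Q.image fun v => Q.erase v ∪ G.neighborFinset v)) := by
    ext C
    simp only [Set.mem_ofPred_eq, hiff, Finset.coe_insert, Finset.coe_image, Set.mem_insert_iff,
      Set.mem_image, Finset.mem_coe, eq_comm]
  rw [hset, Set.ncard_coe_finset, Finset.card_insert_of_notMem, Finset.card_image_of_injOn]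
  · exact fun v hv w hw h => hinj v hv w hw h
  · rw [Finset.mem_image]
    rintro ⟨v, hv, h⟩
    exact hne v hv h.symm
end

section
/- Let G be a finite simple graph and let S and T be configurations of G with |S| = |T|. If T is reachable from S in at most b token-sliding steps, then there exists a bijection σ : S → T such that ∑_{u ∈ S} dist(u, σ(u)) ≤ b. -/
theorem SimpleGraph.Adj.dist_le_dist_add_one {V : Type*} {G : SimpleGraph V} {v w : V}
    (h : G.Adj v w) (u : V) : G.dist u w ≤ G.dist u v + 1 := by
  by_cases hr : G.Reachable u v
  · obtain ⟨p, hp⟩ := hr.exists_walk_length_eq_dist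
    simpa [hp] using SimpleGraph.dist_le (p.concat h)
  · have hw : ¬ G.Reachable u w := fun hw => hr (hw.trans h.symm.reachable)
    simp [SimpleGraph.dist_eq_zero_of_not_reachable hw]

theorem Finset.image_swap_eq_insert_erase {V : Type*} [DecidableEq V] {A : Finset V} {x y : V}
    (hx : x ∈ A) (hy : y ∉ A) : A.image (Equiv.swap x y) = insert y (A.erase x) := by
  ext z
  simp only [Finset.mem_image, Finset.mem_insert, Finset.mem_erase]
  constructor
  · rintro ⟨a, ha, rfl⟩
    by_cases hax : a = x
    · simp [hax]
    · rw [Equiv.swap_apply_of_ne_of_ne hax (ne_of_mem_of_not_mem ha hy)]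
      exact Or.inr ⟨hax, ha⟩
  · rintro (rfl | ⟨hzx, hz⟩)
    · exact ⟨x, hx, Equiv.swap_apply_left x z⟩
    · exact ⟨z, hz, Equiv.swap_apply_of_ne_of_ne hzx (ne_of_mem_of_not_mem hz hy)⟩

/-- A sliding sequence of length `n` induces a permutation of the vertices that carries the first
configuration to the last one and moves its tokens by a total distance of at most `n`. -/
theorem exists_perm_image_eq_sum_dist_le {V : Type*} [DecidableEq V] (G : SimpleGraph V)
    (f : ℕ → Finset V) (n : ℕ) (hf : ∀ i < n, ConfigAdj G (f i) (f (i + 1))) :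
    ∃ π : Equiv.Perm V, (f 0).image π = f n ∧ ∑ u ∈ f 0, G.dist u (π u) ≤ n := by
  induction n with
  | zero => exact ⟨1, by simp, by simp⟩
  | succ n ih =>
    obtain ⟨π, himage, hsum⟩ := ih fun i hi => hf i (by omega)
    obtain ⟨x, hx, y, hy, hxy, hstep⟩ := hf n (by omega)
    refine ⟨π.trans (Equiv.swap x y), ?_, ?_⟩
    · rw [hstep, ← Finset.image_swap_eq_insert_erase hx hy, ← himage, Finset.image_image]
      rfl
    · have hdist : ∀ u ∈ f 0, G.dist u (π.trans (Equiv.swap x y) u) ≤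
          G.dist u (π u) + if u = π.symm x then 1 else 0 := by
        intro u hu
        by_cases hux : u = π.symm x
        · subst hux
          simpa using hxy.dist_le_dist_add_one (π.symm x)
        · have hne : π u ≠ x := fun h => hux (π.eq_symm_apply.2 h)
          have hmem : π u ∈ f n := himage ▸ Finset.mem_image_of_mem π hu
          have hney : π u ≠ y := ne_of_mem_of_not_mem hmem hy
          simp [Equiv.swap_apply_of_ne_of_ne hne hney]
      refine (Finset.sum_le_sum hdist).trans ?_
      rw [Finset.sum_add_distrib, Finset.sum_ite_eq']
      split_ifs <;> omega

theorem stmt_10 {V : Type*} [Fintype V] [DecidableEq V] (G : SimpleGraph V)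
    (S T : Finset V) (hST : S.card = T.card) (b : ℕ)
    (h : ReachableIn G S T b) :
    ∃ σ : {x // x ∈ S} → {x // x ∈ T}, Function.Bijective σ ∧
      ∑ u ∈ S.attach, G.dist u.1 (σ u).1 ≤ b := by
  obtain ⟨n, f, hn, rfl, rfl, hf⟩ := h
  obtain ⟨π, himage, hsum⟩ := exists_perm_image_eq_sum_dist_le G f n hf
  refine ⟨fun u => ⟨π u.1, himage ▸ Finset.mem_image_of_mem π u.2⟩, ⟨?_, ?_⟩, ?_⟩
  · intro u v huv
    exact Subtype.ext (π.injective (congrArg Subtype.val huv))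
  · rintro ⟨z, hz⟩
    obtain ⟨u, hu, rfl⟩ := Finset.mem_image.1 (himage ▸ hz)
    exact ⟨⟨u, hu⟩, rfl⟩
  · exact (Finset.sum_attach (f 0) fun u => G.dist u (π u)).trans_le (hsum.trans hn)
end

section
/- Let G be a connected finite simple graph and let S and T be configurations of G with |S| = |T|. If there exists a bijection σ : S → T such that ∑_{u ∈ S} dist(u, σ(u)) ≤ b, then T is reachable from S in at most b token-sliding steps. -/
theorem ReachableIn.cons {V : Type*} [DecidableEq V] {G : SimpleGraph V} {S S' T : Finset V}
    {b : ℕ} (h : ConfigAdj G S S') (hr : ReachableIn G S' T b) : ReachableIn G S T (b + 1) := by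
  obtain ⟨n, f, hn, h0, hT, hf⟩ := hr
  refine ⟨n + 1, fun i => Nat.casesOn i S f, by omega, rfl, hT, fun i hi => ?_⟩
  cases i with
  | zero => simpa [h0] using h
  | succ k => exact hf k (by omega)

theorem SimpleGraph.Connected.exists_adj_dist_succ {V : Type*} {G : SimpleGraph V}
    (hG : G.Connected) {u v : V} (huv : u ≠ v) :
    ∃ y, G.Adj u y ∧ G.dist y v + 1 ≤ G.dist u v := by
  obtain ⟨p, hp⟩ := hG.exists_walk_length_eq_dist u v
  cases p with
  | nil => exact absurd rfl huv
  | cons h q =>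
    rw [SimpleGraph.Walk.length_cons] at hp
    exact ⟨_, h, by have := SimpleGraph.dist_le q; omega⟩

/-- If a target is unoccupied, some slide strictly decreases the total distance of a suitable
assignment of tokens to targets. -/
theorem exists_configAdj_sum_dist_lt {V : Type*} [DecidableEq V] {G : SimpleGraph V}
    (hG : G.Connected) {S T : Finset V} {v : V} (hv : v ∉ S) (d : ℕ) :
    ∀ (σ : V → V) (u : V), Set.BijOn σ S T → u ∈ S → σ u = v → G.dist u v ≤ d →
      ∃ (S' : Finset V) (τ : V → V), ConfigAdj G S S' ∧ Set.BijOn τ S' T ∧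
        ∑ x ∈ S', G.dist x (τ x) < ∑ x ∈ S, G.dist x (σ x) := by
  induction d with
  | zero =>
    intro σ u _ hu _ hd
    have huv : u = v := hG.dist_eq_zero_iff.mp (Nat.le_zero.mp hd)
    exact absurd (huv ▸ hu) hv
  | succ d ih =>
    intro σ u hσ hu huv hd
    obtain ⟨y, hy, hyd⟩ := hG.exists_adj_dist_succ (ne_of_mem_of_not_mem hu hv)
    have hsum : ∀ R : Finset V, u ∉ R → y ∉ R →
        ∑ x ∈ R, G.dist x ((σ ∘ Equiv.swap u y) x) = ∑ x ∈ R, G.dist x (σ x) := by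
      intro R hu hy
      refine Finset.sum_congr rfl fun x hx => ?_
      rw [Function.comp_apply, Equiv.swap_apply_of_ne_of_ne
        (ne_of_mem_of_not_mem hx hu) (ne_of_mem_of_not_mem hx hy)]
    by_cases hyS : y ∈ S
    · have hswap : Set.BijOn (Equiv.swap u y) S S := by
        refine ⟨fun x hx => ?_, (Equiv.swap u y).injective.injOn, fun x hx =>
          ⟨Equiv.swap u y x, ?_, Equiv.swap_apply_self _ _ _⟩⟩ <;>
        · rw [Equiv.swap_apply_def]
          split_ifs <;> assumption
      obtain ⟨S', τ, hadj, hτ, hlt⟩ := ih (σ ∘ Equiv.swap u y) y (hσ.comp hswap) hyS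
        (by simp [huv]) (by omega)
      refine ⟨S', τ, hadj, hτ, hlt.trans_le ?_⟩
      have hyu : y ∈ S.erase u := Finset.mem_erase.mpr ⟨hy.ne', hyS⟩
      rw [← Finset.add_sum_erase S _ hu, ← Finset.add_sum_erase _ _ hyu,
        ← Finset.add_sum_erase S (fun x => G.dist x (σ x)) hu,
        ← Finset.add_sum_erase _ (fun x => G.dist x (σ x)) hyu, hsum _ (by simp) (by simp)]
      have htri : G.dist u (σ y) ≤ G.dist u y + G.dist y (σ y) := hG.dist_triangle
      rw [SimpleGraph.dist_eq_one_iff_adj.mpr hy] at htri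
      simp only [Function.comp_apply, Equiv.swap_apply_left, Equiv.swap_apply_right, huv]
      omega
    · have hswap : Set.BijOn (Equiv.swap u y) (insert y (S.erase u) : Finset V) S := by
        refine ⟨fun x hx => ?_, (Equiv.swap u y).injective.injOn, fun x hx =>
          ⟨Equiv.swap u y x, ?_, Equiv.swap_apply_self _ _ _⟩⟩ <;>
        · have := hy.ne
          rw [Equiv.swap_apply_def]
          simp only [Finset.mem_coe, Finset.mem_insert, Finset.mem_erase] at hx ⊢
          grind
      refine ⟨_, σ ∘ Equiv.swap u y, ⟨u, hu, y, hyS, hy, rfl⟩, hσ.comp hswap, ?_⟩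
      have hyu : y ∉ S.erase u := fun h => hyS (Finset.mem_of_mem_erase h)
      rw [Finset.sum_insert hyu, ← Finset.add_sum_erase S (fun x => G.dist x (σ x)) hu,
        hsum _ (by simp) hyu]
      simp only [Function.comp_apply, Equiv.swap_apply_right, huv]
      omega

theorem reachableIn_of_bijOn {V : Type*} [DecidableEq V] {G : SimpleGraph V}
    (hG : G.Connected) {T : Finset V} (b : ℕ) :
    ∀ (S : Finset V) (σ : V → V), Set.BijOn σ S T → ∑ x ∈ S, G.dist x (σ x) ≤ b →
      ReachableIn G S T b := by
  induction b with
  | zero =>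
    intro S σ hσ hb
    have hfix : ∀ x ∈ S, x = σ x := fun x hx =>
      hG.dist_eq_zero_iff.mp (Finset.sum_eq_zero_iff.mp (Nat.le_zero.mp hb) x hx)
    have hST : S = T := by
      rw [← Finset.coe_inj, ← hσ.image_eq]
      exact (Set.image_id _).symm.trans (Set.image_congr hfix)
    exact hST ▸ ReachableIn.refl G S 0
  | succ b ih =>
    intro S σ hσ hb
    by_cases hTS : T ⊆ S
    · have hcard : S.card ≤ T.card :=
        Finset.card_le_card_of_injOn σ hσ.mapsTo hσ.injOn
      exact Finset.eq_of_subset_of_card_le hTS hcard ▸ ReachableIn.refl G T (b + 1)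
    · obtain ⟨v, hvT, hvS⟩ := Finset.not_subset.mp hTS
      obtain ⟨u, hu, huv⟩ := hσ.surjOn hvT
      obtain ⟨S', τ, hadj, hτ, hlt⟩ :=
        exists_configAdj_sum_dist_lt hG hvS _ σ u hσ hu huv le_rfl
      exact (ih S' τ hτ (by omega)).cons hadj

theorem stmt_11 {V : Type*} [Fintype V] [DecidableEq V] (G : SimpleGraph V)
    (hG : G.Connected) (S T : Finset V) (hST : S.card = T.card) (b : ℕ)
    (σ : {x // x ∈ S} → {x // x ∈ T}) (hσ : Function.Bijective σ)
    (hsum : ∑ u ∈ S.attach, G.dist u.1 (σ u).1 ≤ b) :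
    ReachableIn G S T b := by
  let τ : V → V := fun x => if h : x ∈ S then (σ ⟨x, h⟩).1 else x
  have hτ : ∀ u : {x // x ∈ S}, τ u.1 = (σ u).1 := fun u => dif_pos u.2
  refine reachableIn_of_bijOn hG b S τ ⟨fun x hx => ?_, fun x hx y hy hxy => ?_, fun y hy => ?_⟩ ?_
  · exact (hτ ⟨x, hx⟩) ▸ (σ ⟨x, hx⟩).2
  · have h := (hτ ⟨x, hx⟩).symm.trans (hxy.trans (hτ ⟨y, hy⟩))
    exact congrArg Subtype.val (hσ.injective (Subtype.ext h))
  · obtain ⟨u, hu⟩ := hσ.surjective ⟨y, hy⟩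
    exact ⟨u.1, u.2, (hτ u).trans (congrArg Subtype.val hu)⟩
  · rw [← Finset.sum_attach]
    simpa only [hτ] using hsum
end
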